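/- Let d ≥ 1 and let K ⊂ ℝ^d be a convex body of volume 1 whose centre of mass is the origin, with E[X ⊗ X] = L² · I_d for X uniform on K, and let k ∈ ℕ satisfy 2^15 · L² ≤ 2^k ≤ 2^16 · L². Let f_{S_k} be the density of S_k = 2^{−k} ∑_{i=1}^{2^k} X_i, where X₁, …, X_{2^k} are independent uniformly random points of K. Then f_{S_k}(0) ≥ e^{−d} · ‖f_{S_k}‖_∞ ≥ e^{d}. -/

import Mathlib

open MeasureTheory Pointwise

/-- `convIter f n` is the `(n+1)`-fold convolution `f ⋆ f ⋆ ⋯ ⋆ f` (with `n + 1`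
copies of `f`) with respect to Lebesgue measure. -/
noncomputable def convIter {d : ℕ} (f : EuclideanSpace ℝ (Fin d) → ℝ) :
    ℕ → EuclideanSpace ℝ (Fin d) → ℝ
  | 0 => f
  | n + 1 => MeasureTheory.convolution f (convIter f n) (ContinuousLinearMap.mul ℝ ℝ) volume

/-- The density of the average `n⁻¹ (X₁ + ⋯ + Xₙ)` of `n` independent uniformly random
points of `K`: `z ↦ n^d · (1_K ⋆ ⋯ ⋆ 1_K)(n z)`. -/
noncomputable def avgDensity {d : ℕ} (K : Set (EuclideanSpace ℝ (Fin d))) (n : ℕ)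
    (z : EuclideanSpace ℝ (Fin d)) : ℝ :=
  (n : ℝ) ^ d * convIter (K.indicator 1) (n - 1) ((n : ℝ) • z)

open scoped ENNReal

theorem volume_add_volume_le_of_isCompact {A B : Set ℝ} (hA : IsCompact A) (hB : IsCompact B)
    (hAn : A.Nonempty) (hBn : B.Nonempty) : volume A + volume B ≤ volume (A + B) := by
  have hM := hA.sSup_mem hAn
  have hm := hB.sInf_mem hBn
  set M := sSup A
  set m := sInf B
  have hAM : ∀ x ∈ A, x ≤ M := fun x hx => le_csSup hA.bddAbove hx
  have hBm : ∀ x ∈ B, m ≤ x := fun x hx => csInf_le hB.bddBelow hx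
  have hdisj : AEDisjoint volume (m +ᵥ A) (M +ᵥ B) := by
    refine measure_mono_null (t := {M + m}) ?_ (by simp)
    rintro _ ⟨⟨x, hx, rfl⟩, ⟨y, hy, hxy⟩⟩
    have h₁ := hAM x hx
    have h₂ := hBm y hy
    simp only [vadd_eq_add] at hxy
    simp only [vadd_eq_add, Set.mem_singleton_iff]
    linarith
  calc volume A + volume B = volume (m +ᵥ A) + volume (M +ᵥ B) := by
        rw [measure_vadd, measure_vadd]
    _ = volume ((m +ᵥ A) ∪ (M +ᵥ B)) :=
        (measure_union₀ (hB.vadd M).measurableSet.nullMeasurableSet hdisj).symm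
    _ ≤ volume (A + B) := by
        refine measure_mono (Set.union_subset ?_ ?_)
        · rintro _ ⟨x, hx, rfl⟩
          exact ⟨x, hx, m, hm, add_comm _ _⟩
        · rintro _ ⟨x, hx, rfl⟩
          exact ⟨M, hM, x, hx, rfl⟩

/-- The one-dimensional Brunn–Minkowski inequality. -/
theorem volume_add_volume_le {A B C : Set ℝ} (hA : MeasurableSet A) (hB : MeasurableSet B)
    (hAn : A.Nonempty) (hBn : B.Nonempty) (hC : A + B ⊆ C) :
    volume A + volume B ≤ volume C := by
  obtain ⟨x, hx⟩ := hAn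
  obtain ⟨y, hy⟩ := hBn
  rw [hA.measure_eq_iSup_isCompact, hB.measure_eq_iSup_isCompact]
  simp only [iSup_and']
  refine ENNReal.biSup_add_biSup_le' ⟨∅, Set.empty_subset _, isCompact_empty⟩
    ⟨∅, Set.empty_subset _, isCompact_empty⟩ ?_
  rintro S ⟨hS, hSc⟩ T ⟨hT, hTc⟩
  calc volume S + volume T ≤ volume (insert x S) + volume (insert y T) := by
        gcongr <;> exact Set.subset_insert _ _
    _ ≤ volume (insert x S + insert y T) :=
        volume_add_volume_le_of_isCompact (hSc.insert x) (hTc.insert y)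
          (Set.insert_nonempty _ _) (Set.insert_nonempty _ _)
    _ ≤ volume C := measure_mono ((Set.add_subset_add (Set.insert_subset hx hS)
          (Set.insert_subset hy hT)).trans hC)

theorem lintegral_eq_lintegral_volume_lt {f : ℝ → ℝ≥0∞} (hf : Measurable f) (hft : ∀ x, f x ≠ ∞) :
    ∫⁻ x, f x = ∫⁻ t in Set.Ioi (0 : ℝ), volume {x | ENNReal.ofReal t < f x} := by
  have h := lintegral_eq_lintegral_meas_lt volume (f := fun x => (f x).toReal)
    (Filter.Eventually.of_forall fun x => ENNReal.toReal_nonneg) hf.ennreal_toReal.aemeasurable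
  simp only [ENNReal.ofReal_toReal (hft _)] at h
  rw [h]
  refine setLIntegral_congr_fun measurableSet_Ioi fun t ht => ?_
  simp only [ENNReal.ofReal_lt_iff_lt_toReal (le_of_lt ht) (hft _)]

theorem ENNReal.rpow_mul_rpow_le_add {a b : ℝ} (ha : 0 < a) (hb : 0 < b) (hab : a + b = 1)
    (x y : ℝ≥0∞) : x ^ a * y ^ b ≤ ENNReal.ofReal a * x + ENNReal.ofReal b * y := by
  by_cases hx : x = ∞
  · simp [hx, ENNReal.mul_top, ha]
  by_cases hy : y = ∞
  · simp [hy, ENNReal.mul_top, hb]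
  lift x to NNReal using hx
  lift y to NNReal using hy
  lift a to NNReal using ha.le
  lift b to NNReal using hb.le
  rw [ENNReal.ofReal_coe_nnreal, ENNReal.ofReal_coe_nnreal,
    ← ENNReal.coe_rpow_of_nonneg _ ha.le, ← ENNReal.coe_rpow_of_nonneg _ hb.le]
  exact_mod_cast NNReal.geom_mean_le_arith_mean2_weighted a b x y (by exact_mod_cast hab)

/-- The Prékopa–Leindler inequality for a measure `μ`, as a property of `μ`. -/
def PrekopaLeindler {E : Type*} [AddCommMonoid E] [Module ℝ E] [MeasurableSpace E]
    (μ : Measure E) : Prop :=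
  ∀ ⦃a b : ℝ⦄, 0 < a → 0 < b → a + b = 1 → ∀ ⦃f g h : E → ℝ≥0∞⦄,
    Measurable f → Measurable g → Measurable h →
    (∀ x y, f x ^ a * g y ^ b ≤ h (a • x + b • y)) →
    (∫⁻ x, f x ∂μ) ^ a * (∫⁻ x, g x ∂μ) ^ b ≤ ∫⁻ x, h x ∂μ

theorem lintegral_add_lintegral_le_of_iSup_eq_one {a b : ℝ} (ha : 0 < a) (hb : 0 < b)
    (hab : a + b = 1) {f g h : ℝ → ℝ≥0∞} (hf : Measurable f) (hg : Measurable g)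
    (hh : Measurable h) (H : ∀ x y, f x ^ a * g y ^ b ≤ h (a • x + b • y))
    (hf1 : ⨆ x, f x = 1) (hg1 : ⨆ x, g x = 1) :
    ENNReal.ofReal a * (∫⁻ x, f x) + ENNReal.ofReal b * (∫⁻ x, g x) ≤ ∫⁻ x, h x := by
  have hfle : ∀ x, f x ≤ 1 := fun x => hf1 ▸ le_iSup f x
  have hgle : ∀ x, g x ≤ 1 := fun x => hg1 ▸ le_iSup g x
  have hmeas : ∀ {u : ℝ → ℝ≥0∞}, Measurable fun t : ℝ => volume {x | ENNReal.ofReal t < u x} := by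
    intro u
    refine Antitone.measurable fun s t hst => measure_mono fun x hx => ?_
    exact (ENNReal.ofReal_le_ofReal hst).trans_lt hx
  refine le_trans ?_ (lintegral_mono fun x => min_le_left (h x) 1)
  rw [lintegral_eq_lintegral_volume_lt hf fun x => ((hfle x).trans_lt ENNReal.one_lt_top).ne,
    lintegral_eq_lintegral_volume_lt hg fun x => ((hgle x).trans_lt ENNReal.one_lt_top).ne,
    lintegral_eq_lintegral_volume_lt (hh.min measurable_const)
      fun x => ((min_le_right (h x) 1).trans_lt ENNReal.one_lt_top).ne,
    ← lintegral_const_mul _ hmeas, ← lintegral_const_mul _ hmeas,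
    ← lintegral_add_left (hmeas.const_mul _)]
  refine lintegral_mono fun t => ?_
  rcases lt_or_ge (ENNReal.ofReal t) 1 with ht | ht
  · have hA : MeasurableSet {x | ENNReal.ofReal t < f x} := measurableSet_lt measurable_const hf
    have hB : MeasurableSet {x | ENNReal.ofReal t < g x} := measurableSet_lt measurable_const hg
    have hAn : {x | ENNReal.ofReal t < f x}.Nonempty := by
      rw [← hf1] at ht
      exact lt_iSup_iff.1 ht
    have hBn : {x | ENNReal.ofReal t < g x}.Nonempty := by
      rw [← hg1] at ht
      exact lt_iSup_iff.1 ht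
    have key := volume_add_volume_le (hA.const_smul₀ a) (hB.const_smul₀ b) (hAn.smul_set)
      (hBn.smul_set) (C := {x | ENNReal.ofReal t < min (h x) 1}) (by
        rintro _ ⟨_, ⟨x, hx, rfl⟩, _, ⟨y, hy, rfl⟩, rfl⟩
        refine lt_min (lt_of_lt_of_le ?_ (H x y)) ht
        calc ENNReal.ofReal t = ENNReal.ofReal t ^ a * ENNReal.ofReal t ^ b := by
              rw [← ENNReal.rpow_add_of_nonneg _ _ ha.le hb.le, hab, ENNReal.rpow_one]
          _ < f x ^ a * g y ^ b :=
              ENNReal.mul_lt_mul (ENNReal.rpow_lt_rpow hx ha) (ENNReal.rpow_lt_rpow hy hb))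
    simpa [Measure.addHaar_smul, abs_of_pos ha, abs_of_pos hb] using key
  · have e₁ : {x | ENNReal.ofReal t < f x} = ∅ :=
      Set.eq_empty_of_forall_notMem fun x hx => ((hfle x).trans ht).not_gt hx
    have e₂ : {x | ENNReal.ofReal t < g x} = ∅ :=
      Set.eq_empty_of_forall_notMem fun x hx => ((hgle x).trans ht).not_gt hx
    simp [e₁, e₂]

theorem prekopaLeindler_real_of_bounded {a b : ℝ} (ha : 0 < a) (hb : 0 < b)
    (hab : a + b = 1) {f g h : ℝ → ℝ≥0∞} (hf : Measurable f) (hg : Measurable g)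
    (hh : Measurable h) (H : ∀ x y, f x ^ a * g y ^ b ≤ h (a • x + b • y))
    (hft : ⨆ x, f x ≠ ∞) (hgt : ⨆ x, g x ≠ ∞) :
    (∫⁻ x, f x) ^ a * (∫⁻ x, g x) ^ b ≤ ∫⁻ x, h x := by
  set A := ⨆ x, f x with hA
  set B := ⨆ x, g x with hB
  rcases eq_or_ne A 0 with hA0 | hA0
  · have : f = 0 := funext (by simpa using ENNReal.iSup_eq_zero.1 hA0)
    simp [this, ha]
  rcases eq_or_ne B 0 with hB0 | hB0
  · have : g = 0 := funext (by simpa using ENNReal.iSup_eq_zero.1 hB0)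
    simp [this, hb]
  have hD0 : A ^ a * B ^ b ≠ 0 := by simp [hA0, hB0, hft, hgt]
  have hDt : A ^ a * B ^ b ≠ ∞ :=
    ENNReal.mul_ne_top (ENNReal.rpow_ne_top_of_nonneg ha.le hft)
      (ENNReal.rpow_ne_top_of_nonneg hb.le hgt)
  have hDinv : (A ^ a * B ^ b)⁻¹ = A⁻¹ ^ a * B⁻¹ ^ b := by
    rw [ENNReal.mul_inv (Or.inr (ENNReal.rpow_ne_top_of_nonneg hb.le hgt))
      (Or.inl (ENNReal.rpow_ne_top_of_nonneg ha.le hft)), ENNReal.inv_rpow, ENNReal.inv_rpow]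
  have key := (ENNReal.rpow_mul_rpow_le_add ha hb hab _ _).trans
    (lintegral_add_lintegral_le_of_iSup_eq_one ha hb hab (hf.const_mul A⁻¹)
    (hg.const_mul B⁻¹) (hh.const_mul (A ^ a * B ^ b)⁻¹) (fun x y => by
      rw [ENNReal.mul_rpow_of_nonneg _ _ ha.le, ENNReal.mul_rpow_of_nonneg _ _ hb.le, hDinv,
        mul_mul_mul_comm]
      gcongr
      exact H x y)
    (by rw [← ENNReal.mul_iSup, ENNReal.inv_mul_cancel hA0 hft])
    (by rw [← ENNReal.mul_iSup, ENNReal.inv_mul_cancel hB0 hgt]))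
  rw [lintegral_const_mul _ hf, lintegral_const_mul _ hg, lintegral_const_mul _ hh,
    ENNReal.mul_rpow_of_nonneg _ _ ha.le, ENNReal.mul_rpow_of_nonneg _ _ hb.le,
    mul_mul_mul_comm, ← hDinv] at key
  exact (ENNReal.mul_le_mul_iff_right (ENNReal.inv_ne_zero.2 hDt) (ENNReal.inv_ne_top.2 hD0)).1 key

theorem tendsto_lintegral_min_natCast {f : ℝ → ℝ≥0∞} (hf : Measurable f) :
    Filter.Tendsto (fun n : ℕ => ∫⁻ x, min (f x) n) Filter.atTop (nhds (∫⁻ x, f x)) := by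
  refine lintegral_tendsto_of_tendsto_of_monotone (fun n => (hf.min measurable_const).aemeasurable)
    (Filter.Eventually.of_forall fun x m n hmn => ?_) (Filter.Eventually.of_forall fun x => ?_)
  · dsimp only
    gcongr
  · have := (tendsto_const_nhds (x := f x)).min ENNReal.tendsto_nat_nhds_top
    simpa using this

theorem prekopaLeindler_real : PrekopaLeindler (volume : Measure ℝ) := by
  intro a b ha hb hab f g h hf hg hh H
  rcases eq_or_ne (∫⁻ x, f x) 0 with hf0 | hf0
  · simp [hf0, ha]
  rcases eq_or_ne (∫⁻ x, g x) 0 with hg0 | hg0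
  · simp [hg0, hb]
  have hlim := ENNReal.Tendsto.mul
    ((ENNReal.continuous_rpow_const (y := a)).continuousAt.tendsto.comp
      (tendsto_lintegral_min_natCast hf)) (Or.inl (by simp [hf0, ha.not_gt]))
    ((ENNReal.continuous_rpow_const (y := b)).continuousAt.tendsto.comp
      (tendsto_lintegral_min_natCast hg)) (Or.inl (by simp [hg0, hb.not_gt]))
  refine le_of_tendsto hlim (Filter.Eventually.of_forall fun n => ?_)
  refine prekopaLeindler_real_of_bounded ha hb hab (hf.min measurable_const)
    (hg.min measurable_const) hh (fun x y => le_trans ?_ (H x y)) ?_ ?_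
  · gcongr <;> exact min_le_left _ _
  · exact ((iSup_le fun x => min_le_right _ _).trans_lt (ENNReal.natCast_lt_top n)).ne
  · exact ((iSup_le fun x => min_le_right _ _).trans_lt (ENNReal.natCast_lt_top n)).ne

theorem PrekopaLeindler.prod {E F : Type*} [AddCommMonoid E] [Module ℝ E] [MeasurableSpace E]
    [AddCommMonoid F] [Module ℝ F] [MeasurableSpace F] {μ : Measure E} {ν : Measure F}
    [SFinite ν] (hμ : PrekopaLeindler μ) (hν : PrekopaLeindler ν) :
    PrekopaLeindler (μ.prod ν) := by
  intro a b ha hb hab f g h hf hg hh H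
  rw [lintegral_prod _ hf.aemeasurable, lintegral_prod _ hg.aemeasurable,
    lintegral_prod _ hh.aemeasurable]
  refine hμ ha hb hab hf.lintegral_prod_right' hg.lintegral_prod_right'
    hh.lintegral_prod_right' fun x y => ?_
  exact hν ha hb hab (hf.comp measurable_prodMk_left) (hg.comp measurable_prodMk_left)
    (hh.comp measurable_prodMk_left) fun u v => H (x, u) (y, v)

theorem PrekopaLeindler.of_measurePreserving {E F : Type*} [AddCommMonoid E] [Module ℝ E]
    [MeasurableSpace E] [AddCommMonoid F] [Module ℝ F] [MeasurableSpace F] {μ : Measure E}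
    {ν : Measure F} (hμ : PrekopaLeindler μ) {e : E → F} (he : MeasurePreserving e μ ν)
    (hlin : ∀ (a b : ℝ) (x y : E), e (a • x + b • y) = a • e x + b • e y) :
    PrekopaLeindler ν := by
  intro a b ha hb hab f g h hf hg hh H
  rw [← he.lintegral_comp hf, ← he.lintegral_comp hg, ← he.lintegral_comp hh]
  exact hμ ha hb hab (hf.comp he.measurable) (hg.comp he.measurable) (hh.comp he.measurable)
    fun x y => hlin a b x y ▸ H (e x) (e y)

theorem prekopaLeindler_pi (d : ℕ) : PrekopaLeindler (volume : Measure (Fin d → ℝ)) := by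
  induction d with
  | zero =>
    intro a b ha hb hab f g h hf hg hh H
    have e : (volume : Measure (Fin 0 → ℝ)) = Measure.dirac 0 := by
      rw [volume_pi, Measure.pi_of_empty _ 0]
    rw [e, lintegral_dirac' _ hf, lintegral_dirac' _ hg, lintegral_dirac' _ hh]
    simpa using H 0 0
  | succ d ih =>
    refine (prekopaLeindler_real.prod ih).of_measurePreserving
      (volume_preserving_piFinSuccAbove (fun _ : Fin (d + 1) => ℝ) 0).symm fun a b x y => ?_
    ext i
    refine Fin.cases ?_ (fun j => ?_) i <;> simp [MeasurableEquiv.piFinSuccAbove]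

theorem prekopaLeindler_euclideanSpace (d : ℕ) :
    PrekopaLeindler (volume : Measure (EuclideanSpace ℝ (Fin d))) :=
  (prekopaLeindler_pi d).of_measurePreserving (PiLp.volume_preserving_toLp (Fin d))
    fun _ _ _ _ => rfl

/-- Bounded, compactly supported, upper semicontinuous log-concave functions. -/
structure IsLogConcaveBump {d : ℕ} (f : EuclideanSpace ℝ (Fin d) → ℝ) : Prop where
  nonneg : ∀ x, 0 ≤ f x
  le_one : ∀ x, f x ≤ 1
  hasCompactSupport : HasCompactSupport f
  upperSemicontinuous : UpperSemicontinuous f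
  rpow_mul_rpow_le : ∀ ⦃a b : ℝ⦄, 0 < a → 0 < b → a + b = 1 →
    ∀ x y, f x ^ a * f y ^ b ≤ f (a • x + b • y)

namespace IsLogConcaveBump

variable {d : ℕ} {f : EuclideanSpace ℝ (Fin d) → ℝ}

theorem measurable (hf : IsLogConcaveBump f) : Measurable f :=
  hf.upperSemicontinuous.measurable

theorem integrable_of_bounded {g : EuclideanSpace ℝ (Fin d) → ℝ} (hg : Measurable g)
    (hc : HasCompactSupport g) {C : ℝ} (hC : ∀ x, ‖g x‖ ≤ C) : Integrable g := by
  rw [← integrableOn_iff_integrable_of_support_subset (subset_tsupport g)]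
  exact Measure.integrableOn_of_bounded (M := C) hc.isCompact.measure_lt_top.ne
    hg.aestronglyMeasurable (Filter.Eventually.of_forall hC)

theorem integrable (hf : IsLogConcaveBump f) : Integrable f :=
  integrable_of_bounded hf.measurable hf.hasCompactSupport (C := 1) fun x => by
    rw [Real.norm_of_nonneg (hf.nonneg x)]
    exact hf.le_one x

theorem integrable_mul (hf : IsLogConcaveBump f) {φ : EuclideanSpace ℝ (Fin d) → ℝ}
    (hφ : Continuous φ) : Integrable fun x => φ x * f x := by
  have hs : Function.support (fun x => φ x * f x) ⊆ tsupport f :=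
    (Function.support_mul_subset_right _ _).trans (subset_tsupport f)
  rw [← integrableOn_iff_integrable_of_support_subset hs]
  exact hf.integrable.integrableOn.continuousOn_mul hφ.continuousOn hf.hasCompactSupport.isCompact

theorem integrable_mul_log (hf : IsLogConcaveBump f) :
    Integrable fun x => f x * Real.log (f x) := by
  refine integrable_of_bounded (hf.measurable.mul (Real.measurable_log.comp hf.measurable))
    (hf.hasCompactSupport.mul_right) (C := 1) fun x => ?_
  rcases (hf.nonneg x).eq_or_lt with h | h
  · simp [← h]
  · have := Real.abs_log_mul_self_lt (f x) h (hf.le_one x)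
    rw [mul_comm, Real.norm_eq_abs]
    exact this.le

/-- Jensen's inequality for the concave function `log f` and the probability density `f`. -/
theorem exp_integral_mul_log_le (hf : IsLogConcaveBump f) (hf1 : ∫ x, f x = 1)
    (hf0 : ∀ i, ∫ x, x i * f x = 0) : Real.exp (∫ x, f x * Real.log (f x)) ≤ f 0 := by
  set ν : Measure (EuclideanSpace ℝ (Fin d)) :=
    volume.withDensity fun x => ENNReal.ofReal (f x) with hν
  have hmeas : Measurable fun x => ENNReal.ofReal (f x) := hf.measurable.ennreal_ofReal
  have hlt : ∀ᵐ x : EuclideanSpace ℝ (Fin d), ENNReal.ofReal (f x) < ∞ := by simp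
  have : IsProbabilityMeasure ν := ⟨by
    rw [hν, withDensity_apply _ MeasurableSet.univ, Measure.restrict_univ,
      ← ofReal_integral_eq_lintegral_ofReal hf.integrable
        (Filter.Eventually.of_forall hf.nonneg), hf1, ENNReal.ofReal_one]⟩
  set S : Set (EuclideanSpace ℝ (Fin d) × ℝ) := {p | Real.exp p.2 ≤ f p.1} with hS
  have hSclosed : IsClosed S :=
    (upperSemicontinuous_iff_IsClosed_hypograph.1 hf.upperSemicontinuous).preimage
      (f := fun p : EuclideanSpace ℝ (Fin d) × ℝ => (p.1, Real.exp p.2)) (by fun_prop)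
  have hSconv : Convex ℝ S := by
    rw [convex_iff_pairwise_pos]
    rintro ⟨x, s⟩ hx ⟨y, t⟩ hy - a b ha hb hab
    refine le_trans ?_ (hf.rpow_mul_rpow_le ha hb hab x y)
    calc Real.exp (a • s + b • t) = Real.exp s ^ a * Real.exp t ^ b := by
          rw [← Real.exp_mul, ← Real.exp_mul, ← Real.exp_add]
          simp [mul_comm]
      _ ≤ f x ^ a * f y ^ b := by
          have hx' : Real.exp s ≤ f x := hx
          have hy' : Real.exp t ≤ f y := hy
          have := hf.nonneg x
          gcongr
  have hmem : ∀ᵐ x ∂ν, (x, Real.log (f x)) ∈ S := by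
    rw [hν, ae_withDensity_iff hmeas]
    refine Filter.Eventually.of_forall fun x hx => ?_
    have hx : 0 < f x := by simpa using hx
    exact (Real.exp_log hx).le
  have hint_id : Integrable (fun x => x) ν := by
    rw [hν, integrable_withDensity_iff_integrable_smul' hmeas hlt]
    simp only [ENNReal.toReal_ofReal (hf.nonneg _)]
    refine Integrable.of_eval_piLp (q := 2) fun i => ?_
    simpa [mul_comm] using! hf.integrable_mul (φ := fun x => x i) (by fun_prop)
  have hint_log : Integrable (fun x => Real.log (f x)) ν := by
    rw [hν, integrable_withDensity_iff_integrable_smul' hmeas hlt]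
    simpa only [ENNReal.toReal_ofReal (hf.nonneg _)] using! hf.integrable_mul_log
  have key := hSconv.integral_mem hSclosed hmem (hint_id.prodMk hint_log)
  rw [integral_pair hint_id hint_log] at key
  have e₁ : ∫ x, x ∂ν = 0 := by
    ext i
    have := (EuclideanSpace.proj i : EuclideanSpace ℝ (Fin d) →L[ℝ] ℝ).integral_comp_comm hint_id
    simp only [PiLp.proj_apply] at this
    rw [← this, hν, integral_withDensity_eq_integral_toReal_smul hmeas hlt]
    simp only [ENNReal.toReal_ofReal (hf.nonneg _), smul_eq_mul, PiLp.zero_apply]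
    rw [← hf0 i]
    simp only [mul_comm]
  have e₂ : ∫ x, Real.log (f x) ∂ν = ∫ x, f x * Real.log (f x) := by
    rw [hν, integral_withDensity_eq_integral_toReal_smul hmeas hlt]
    simp only [ENNReal.toReal_ofReal (hf.nonneg _), smul_eq_mul]
  simpa [hS, e₁, e₂] using key

theorem one_add_mul_log_sub_le (hf : IsLogConcaveBump f) (hf1 : ∫ x, f x = 1)
    {y : EuclideanSpace ℝ (Fin d)} (hy : 0 < f y) {ε : ℝ} (hε : 0 < ε) (hε1 : ε < 1) :
    1 + ε * (Real.log (f y) - ∫ x, f x * Real.log (f x)) ≤ ((1 - ε) ^ d)⁻¹ := by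
  have hr : 0 < 1 - ε := by linarith
  have hscale : ∫ x, f (ε • y + (1 - ε) • x) = ((1 - ε) ^ d)⁻¹ := by
    rw [Measure.integral_comp_smul_of_nonneg volume (fun x => f (ε • y + x)) (1 - ε) (hR := hr.le),
      integral_add_left_eq_self, hf1]
    simp
  have hint₂ : Integrable fun x => f (ε • y + (1 - ε) • x) :=
    (hf.integrable.comp_add_left (ε • y)).comp_smul hr.ne'
  have hint₀ : Integrable fun x => ε * (Real.log (f y) * f x - f x * Real.log (f x)) :=
    ((hf.integrable.const_mul _).sub hf.integrable_mul_log).const_mul _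
  have hle : ∀ x, f x + ε * (Real.log (f y) * f x - f x * Real.log (f x))
      ≤ f (ε • y + (1 - ε) • x) := by
    intro x
    rcases (hf.nonneg x).eq_or_lt with h | h
    · rw [← h]
      simpa using hf.nonneg _
    refine le_trans ?_ (hf.rpow_mul_rpow_le hε hr (by ring) y x)
    have h₁ : f y ^ ε * f x ^ (1 - ε) = f x * Real.exp (ε * (Real.log (f y) - Real.log (f x))) := by
      conv_rhs => rw [← Real.exp_log h, Real.log_exp, ← Real.exp_add]
      rw [Real.rpow_def_of_pos hy, Real.rpow_def_of_pos h, ← Real.exp_add]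
      congr 1
      ring
    have h₂ := Real.add_one_le_exp (ε * (Real.log (f y) - Real.log (f x)))
    rw [h₁]
    nlinarith [mul_le_mul_of_nonneg_left h₂ h.le]
  have key := integral_mono (hf.integrable.add hint₀) hint₂ hle
  rw [hscale, integral_add' hf.integrable hint₀, integral_const_mul,
    integral_sub (hf.integrable.const_mul _) hf.integrable_mul_log, integral_const_mul, hf1] at key
  simpa using key

theorem log_sub_integral_mul_log_le (hf : IsLogConcaveBump f) (hf1 : ∫ x, f x = 1)
    {y : EuclideanSpace ℝ (Fin d)} (hy : 0 < f y) :
    Real.log (f y) - ∫ x, f x * Real.log (f x) ≤ d := by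
  set H := Real.log (f y) - ∫ x, f x * Real.log (f x) with hH
  by_contra! hlt
  have hd0 : (0 : ℝ) ≤ d := Nat.cast_nonneg d
  have hHpos : 0 < H := hd0.trans_lt hlt
  obtain ⟨ε, hε, hε1, hεH⟩ : ∃ ε : ℝ, 0 < ε ∧ ε < 1 ∧ ε * (d * H) < H - d := by
    refine ⟨min (1 / 2) ((H - d) / (2 * (d * H + 1))), ?_, ?_, ?_⟩
    · have : 0 < H - d := by linarith
      positivity
    · exact (min_le_left _ _).trans_lt (by norm_num)
    · have hp : 0 < d * H + 1 := by positivity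
      calc _ ≤ (H - d) / (2 * (d * H + 1)) * (d * H) := by gcongr; exact min_le_right _ _
        _ < H - d := by
          rw [div_mul_eq_mul_div, div_lt_iff₀ (by positivity)]
          nlinarith [mul_nonneg hd0 hHpos.le]
  have h₁ := hf.one_add_mul_log_sub_le hf1 hy hε hε1
  rw [← hH, ← one_div, le_div_iff₀ (pow_pos (by linarith) d)] at h₁
  have h₂ : 1 + (d : ℝ) * (-ε) ≤ (1 + -ε) ^ d := one_add_mul_le_pow (by linarith) d
  rw [← sub_eq_add_neg] at h₂
  have h₃ : (1 + ε * H) * (1 + d * (-ε)) ≤ 1 :=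
    (mul_le_mul_of_nonneg_left h₂ (by positivity)).trans h₁
  nlinarith

/-- A centred log-concave density on `ℝ^d` is at most `e^d` times its value at the origin. -/
theorem le_exp_mul_apply_zero (hf : IsLogConcaveBump f) (hf1 : ∫ x, f x = 1)
    (hf0 : ∀ i, ∫ x, x i * f x = 0) (y : EuclideanSpace ℝ (Fin d)) :
    f y ≤ Real.exp d * f 0 := by
  rcases (hf.nonneg y).eq_or_lt with h | h
  · rw [← h]
    exact mul_nonneg (Real.exp_pos _).le (hf.nonneg 0)
  calc f y = Real.exp (Real.log (f y)) := (Real.exp_log h).symm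
    _ ≤ Real.exp (d + ∫ x, f x * Real.log (f x)) := by
        gcongr
        linarith [hf.log_sub_integral_mul_log_le hf1 h]
    _ ≤ Real.exp d * f 0 := by
        rw [Real.exp_add]
        gcongr
        exact hf.exp_integral_mul_log_le hf1 hf0

theorem indicator {K : Set (EuclideanSpace ℝ (Fin d))} (hK : IsCompact K) (hc : Convex ℝ K) :
    IsLogConcaveBump (K.indicator (1 : EuclideanSpace ℝ (Fin d) → ℝ)) where
  nonneg := Set.indicator_nonneg fun _ _ => zero_le_one
  le_one := Set.indicator_le_self' (fun _ _ => zero_le_one)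
  hasCompactSupport := HasCompactSupport.intro hK fun x hx => Set.indicator_of_notMem hx _
  upperSemicontinuous := hK.isClosed.upperSemicontinuous_indicator zero_le_one
  rpow_mul_rpow_le := by
    intro a b ha hb hab x y
    have hnn : (0 : ℝ) ≤ K.indicator 1 (a • x + b • y) :=
      Set.indicator_nonneg (fun _ _ => zero_le_one) _
    by_cases hx : x ∈ K
    · by_cases hy : y ∈ K
      · simp [hx, hy, hc hx hy ha.le hb.le hab]
      · simpa [hy, hb.ne'] using hnn
    · simpa [hx, ha.ne'] using hnn


theorem integrable_mul_comp_sub (hf : IsLogConcaveBump f) {g : EuclideanSpace ℝ (Fin d) → ℝ}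
    (hg : IsLogConcaveBump g) (z : EuclideanSpace ℝ (Fin d)) :
    Integrable fun t => f t * g (z - t) := by
  refine integrable_of_bounded (hf.measurable.mul (hg.measurable.comp (by fun_prop)))
    hf.hasCompactSupport.mul_right (C := 1) fun t => ?_
  rw [Real.norm_of_nonneg (mul_nonneg (hf.nonneg _) (hg.nonneg _))]
  exact mul_le_one₀ (hf.le_one _) (hg.nonneg _) (hg.le_one _)

theorem ofReal_convolution (hf : IsLogConcaveBump f) {g : EuclideanSpace ℝ (Fin d) → ℝ}
    (hg : IsLogConcaveBump g) (z : EuclideanSpace ℝ (Fin d)) :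
    ENNReal.ofReal (convolution f g (ContinuousLinearMap.mul ℝ ℝ) volume z)
      = ∫⁻ t, ENNReal.ofReal (f t * g (z - t)) :=
  ofReal_integral_eq_lintegral_ofReal (hf.integrable_mul_comp_sub hg z)
    (Filter.Eventually.of_forall fun _ => mul_nonneg (hf.nonneg _) (hg.nonneg _))

theorem convolution_nonneg (hf : IsLogConcaveBump f) {g : EuclideanSpace ℝ (Fin d) → ℝ}
    (hg : IsLogConcaveBump g) (z : EuclideanSpace ℝ (Fin d)) :
    0 ≤ convolution f g (ContinuousLinearMap.mul ℝ ℝ) volume z :=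
  integral_nonneg fun _ => mul_nonneg (hf.nonneg _) (hg.nonneg _)

theorem convolution_rpow_mul_rpow_le (hf : IsLogConcaveBump f)
    {g : EuclideanSpace ℝ (Fin d) → ℝ} (hg : IsLogConcaveBump g) {a b : ℝ} (ha : 0 < a)
    (hb : 0 < b) (hab : a + b = 1) (x y : EuclideanSpace ℝ (Fin d)) :
    convolution f g (ContinuousLinearMap.mul ℝ ℝ) volume x ^ a *
        convolution f g (ContinuousLinearMap.mul ℝ ℝ) volume y ^ b
      ≤ convolution f g (ContinuousLinearMap.mul ℝ ℝ) volume (a • x + b • y) := by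
  have hmeas : ∀ z, Measurable fun t => ENNReal.ofReal (f t * g (z - t)) := fun z =>
    (hf.measurable.mul (hg.measurable.comp (by fun_prop))).ennreal_ofReal
  have hnn : ∀ z t, 0 ≤ f t * g (z - t) := fun z t => mul_nonneg (hf.nonneg _) (hg.nonneg _)
  rw [← ENNReal.ofReal_le_ofReal_iff (hf.convolution_nonneg hg _),
    ENNReal.ofReal_mul (Real.rpow_nonneg (hf.convolution_nonneg hg _) _),
    ← ENNReal.ofReal_rpow_of_nonneg (hf.convolution_nonneg hg _) ha.le,
    ← ENNReal.ofReal_rpow_of_nonneg (hf.convolution_nonneg hg _) hb.le,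
    hf.ofReal_convolution hg, hf.ofReal_convolution hg, hf.ofReal_convolution hg]
  refine prekopaLeindler_euclideanSpace d ha hb hab (hmeas x) (hmeas y) (hmeas _) fun s t => ?_
  rw [ENNReal.ofReal_rpow_of_nonneg (hnn _ _) ha.le, ENNReal.ofReal_rpow_of_nonneg (hnn _ _) hb.le,
    ← ENNReal.ofReal_mul (Real.rpow_nonneg (hnn _ _) _)]
  refine ENNReal.ofReal_le_ofReal ?_
  have e : a • x + b • y - (a • s + b • t) = a • (x - s) + b • (y - t) := by module
  rw [Real.mul_rpow (hf.nonneg _) (hg.nonneg _), Real.mul_rpow (hf.nonneg _) (hg.nonneg _),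
    mul_mul_mul_comm, e]
  exact mul_le_mul (hf.rpow_mul_rpow_le ha hb hab s t) (hg.rpow_mul_rpow_le ha hb hab _ _)
    (mul_nonneg (Real.rpow_nonneg (hg.nonneg _) _) (Real.rpow_nonneg (hg.nonneg _) _))
    (hf.nonneg _)

end IsLogConcaveBump

theorem continuousAt_indicator_one_of_notMem_frontier {X : Type*} [TopologicalSpace X]
    {K : Set X} {x : X} (hx : x ∉ frontier K) :
    ContinuousAt (K.indicator (1 : X → ℝ)) x := by
  by_cases hxK : x ∈ interior K
  · refine (continuousAt_const (y := (1 : ℝ))).congr ?_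
    filter_upwards [isOpen_interior.mem_nhds hxK] with y hy
    simp [interior_subset hy]
  · refine (continuousAt_const (y := (0 : ℝ))).congr ?_
    have hxc : x ∈ (closure K)ᶜ := fun h => hx ⟨h, hxK⟩
    filter_upwards [isClosed_closure.isOpen_compl.mem_nhds hxc] with y hy
    have : y ∉ K := fun h => hy (subset_closure h)
    simp [this]

theorem Convex.continuous_indicator_convolution {d : ℕ} {K : Set (EuclideanSpace ℝ (Fin d))}
    (hK : MeasurableSet K) (hc : Convex ℝ K) {g : EuclideanSpace ℝ (Fin d) → ℝ}
    (hg : Integrable g) :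
    Continuous (convolution (K.indicator 1) g (ContinuousLinearMap.mul ℝ ℝ) volume) := by
  have e : convolution (K.indicator 1) g (ContinuousLinearMap.mul ℝ ℝ) volume
      = fun x => ∫ t, K.indicator 1 (x - t) * g t := funext fun x => convolution_eq_swap _
  rw [e, continuous_iff_continuousAt]
  intro x₀
  have hmeas : Measurable (K.indicator (1 : EuclideanSpace ℝ (Fin d) → ℝ)) :=
    measurable_one.indicator hK
  refine continuousAt_of_dominated (bound := fun t => ‖g t‖)
    (Filter.Eventually.of_forall fun x =>
      (hmeas.comp (by fun_prop)).aestronglyMeasurable.mul hg.aestronglyMeasurable)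
    (Filter.Eventually.of_forall fun x => Filter.Eventually.of_forall fun t => ?_) hg.norm ?_
  · rw [norm_mul]
    refine mul_le_of_le_one_left (norm_nonneg _) ?_
    by_cases h : x - t ∈ K <;> simp [h]
  · have h0 : ∀ᵐ t : EuclideanSpace ℝ (Fin d), t ∉ frontier K :=
      measure_eq_zero_iff_ae_notMem.1 (hc.addHaar_frontier volume)
    filter_upwards [(Measure.measurePreserving_sub_left volume x₀).quasiMeasurePreserving.ae h0] with t ht
    exact ((continuousAt_indicator_one_of_notMem_frontier ht).comp
      (f := fun x => x - t) (by fun_prop)).mul continuousAt_const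

theorem IsLogConcaveBump.indicator_convolution {d : ℕ} {K : Set (EuclideanSpace ℝ (Fin d))}
    (hK : IsCompact K) (hc : Convex ℝ K) (hvol : volume K = 1)
    {g : EuclideanSpace ℝ (Fin d) → ℝ} (hg : IsLogConcaveBump g) :
    IsLogConcaveBump (convolution (K.indicator 1) g (ContinuousLinearMap.mul ℝ ℝ) volume) := by
  have hf := IsLogConcaveBump.indicator hK hc
  refine ⟨hf.convolution_nonneg hg, fun z => ?_, hf.hasCompactSupport.convolution _
    hg.hasCompactSupport, (hc.continuous_indicator_convolution hK.measurableSet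
    hg.integrable).upperSemicontinuous, fun a b => hf.convolution_rpow_mul_rpow_le hg⟩
  calc convolution (K.indicator 1) g (ContinuousLinearMap.mul ℝ ℝ) volume z
      ≤ ∫ t, K.indicator 1 t :=
        integral_mono (hf.integrable_mul_comp_sub hg z) hf.integrable fun t =>
          mul_le_of_le_one_right (hf.nonneg t) (hg.le_one _)
    _ = 1 := by
        rw [integral_indicator_one hK.measurableSet, measureReal_def, hvol, ENNReal.toReal_one]

section Moments

variable {d : ℕ} {f g : EuclideanSpace ℝ (Fin d) → ℝ}

theorem integral_mul_convolution_eq (i : Fin d) (hf : Integrable f) (hg : Integrable g)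
    (hf₁ : Integrable fun x => x i * f x) (hg₁ : Integrable fun x => x i * g x) :
    ∫ z, z i * convolution f g (ContinuousLinearMap.mul ℝ ℝ) volume z
      = (∫ x, x i * f x) * (∫ x, g x) + (∫ x, f x) * ∫ x, x i * g x := by
  set B := ContinuousLinearMap.mul ℝ ℝ with hB
  have e : ∀ᵐ z, z i * convolution f g B volume z =
      convolution (fun x => x i * f x) g B volume z
        + convolution f (fun x => x i * g x) B volume z := by
    filter_upwards [hf₁.ae_convolution_exists B hg, hf.ae_convolution_exists B hg₁]
      with z h₁ h₂
    rw [convolution_def, convolution_def, convolution_def, ← integral_const_mul,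
      ← integral_add h₁ h₂]
    refine integral_congr_ae (Filter.Eventually.of_forall fun t => ?_)
    simp only [hB, ContinuousLinearMap.mul_apply', PiLp.sub_apply]
    ring
  rw [integral_congr_ae e, integral_add (hf₁.integrable_convolution B hg)
    (hf.integrable_convolution B hg₁), integral_convolution B hf₁ hg, integral_convolution B hf hg₁]
  simp [hB]

theorem integral_sq_mul_convolution_eq (i : Fin d) (hf : Integrable f) (hg : Integrable g)
    (hf₁ : Integrable fun x => x i * f x) (hg₁ : Integrable fun x => x i * g x)
    (hf₂ : Integrable fun x => x i ^ 2 * f x) (hg₂ : Integrable fun x => x i ^ 2 * g x) :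
    ∫ z, z i ^ 2 * convolution f g (ContinuousLinearMap.mul ℝ ℝ) volume z
      = (∫ x, x i ^ 2 * f x) * (∫ x, g x) + 2 * ((∫ x, x i * f x) * ∫ x, x i * g x)
        + (∫ x, f x) * ∫ x, x i ^ 2 * g x := by
  set B := ContinuousLinearMap.mul ℝ ℝ with hB
  have e : ∀ᵐ z, z i ^ 2 * convolution f g B volume z =
      convolution (fun x => x i ^ 2 * f x) g B volume z
        + 2 * convolution (fun x => x i * f x) (fun x => x i * g x) B volume z
        + convolution f (fun x => x i ^ 2 * g x) B volume z := by
    filter_upwards [hf₂.ae_convolution_exists B hg, hf₁.ae_convolution_exists B hg₁,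
      hf.ae_convolution_exists B hg₂] with z h₁ h₂ h₃
    rw [convolution_def, convolution_def, convolution_def, convolution_def, ← integral_const_mul,
      ← integral_const_mul]
    refine .trans ?_ ((integral_add (h₁.add (h₂.const_mul 2)) h₃).trans
      (congrArg (· + _) (integral_add h₁ (h₂.const_mul 2))))
    refine integral_congr_ae (Filter.Eventually.of_forall fun t => ?_)
    simp only [hB, ContinuousLinearMap.mul_apply', PiLp.sub_apply, Pi.add_apply]
    ring
  have i₁ := hf₂.integrable_convolution B hg
  have i₂ := (hf₁.integrable_convolution B hg₁).const_mul 2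
  rw [integral_congr_ae e]
  refine ((integral_add (i₁.add i₂) (hf.integrable_convolution B hg₂)).trans
    (congrArg (· + _) (integral_add i₁ i₂))).trans ?_
  rw [integral_const_mul, integral_convolution B hf₂ hg,
    integral_convolution B hf₁ hg₁, integral_convolution B hf hg₂]
  simp [hB]

end Moments

section ConvIter

variable {d : ℕ} {K : Set (EuclideanSpace ℝ (Fin d))}

theorem isLogConcaveBump_convIter (hK : IsCompact K) (hc : Convex ℝ K) (hvol : volume K = 1)
    (m : ℕ) : IsLogConcaveBump (convIter (K.indicator 1) m) := by
  induction m with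
  | zero => exact .indicator hK hc
  | succ m ih => exact .indicator_convolution hK hc hvol ih

theorem integral_mul_indicator_one (hK : MeasurableSet K) (φ : EuclideanSpace ℝ (Fin d) → ℝ) :
    ∫ x, φ x * K.indicator 1 x = ∫ x in K, φ x := by
  rw [← integral_indicator hK]
  congr 1 with x
  by_cases hx : x ∈ K <;> simp [hx]

theorem integral_convIter (hK : IsCompact K) (hc : Convex ℝ K) (hvol : volume K = 1) (m : ℕ) :
    ∫ x, convIter (K.indicator 1) m x = 1 := by
  have h0 : ∫ x, K.indicator (1 : EuclideanSpace ℝ (Fin d) → ℝ) x = 1 := by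
    rw [integral_indicator_one hK.measurableSet, measureReal_def, hvol, ENNReal.toReal_one]
  induction m with
  | zero => exact h0
  | succ m ih =>
    simp only [convIter]
    rw [integral_convolution _ (IsLogConcaveBump.indicator hK hc).integrable
      (isLogConcaveBump_convIter hK hc hvol m).integrable, h0, ih]
    simp

theorem integral_mul_convIter (hK : IsCompact K) (hc : Convex ℝ K) (hvol : volume K = 1)
    {i : Fin d} (hcen : ∫ x in K, x i = 0) (m : ℕ) :
    ∫ x, x i * convIter (K.indicator 1) m x = 0 := by
  have h0 := (integral_mul_indicator_one hK.measurableSet fun x => x i).trans hcen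
  induction m with
  | zero => exact h0
  | succ m ih =>
    have hf := IsLogConcaveBump.indicator hK hc
    have hg := isLogConcaveBump_convIter hK hc hvol m
    simp only [convIter]
    rw [integral_mul_convolution_eq i hf.integrable hg.integrable
      (hf.integrable_mul (by fun_prop)) (hg.integrable_mul (by fun_prop)), h0, ih]
    simp

theorem integral_sq_mul_convIter (hK : IsCompact K) (hc : Convex ℝ K) (hvol : volume K = 1)
    {i : Fin d} (hcen : ∫ x in K, x i = 0) {v : ℝ} (hvar : ∫ x in K, x i ^ 2 = v) (m : ℕ) :
    ∫ x, x i ^ 2 * convIter (K.indicator 1) m x = (m + 1) * v := by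
  have h0 := (integral_mul_indicator_one hK.measurableSet fun x => x i ^ 2).trans hvar
  induction m with
  | zero => simpa using! h0
  | succ m ih =>
    have hf := IsLogConcaveBump.indicator hK hc
    have hg := isLogConcaveBump_convIter hK hc hvol m
    simp only [convIter]
    rw [integral_sq_mul_convolution_eq i hf.integrable hg.integrable
      (hf.integrable_mul (by fun_prop)) (hg.integrable_mul (by fun_prop))
      (hf.integrable_mul (by fun_prop)) (hg.integrable_mul (by fun_prop)), h0, ih,
      integral_mul_convIter hK hc hvol hcen m, integral_convIter hK hc hvol m]
    have h1 : ∫ x, K.indicator (1 : EuclideanSpace ℝ (Fin d) → ℝ) x = 1 :=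
      integral_convIter hK hc hvol 0
    rw [h1]
    push_cast
    ring

end ConvIter

/-- If a log-concave density `f` satisfies `a ∫ ‖x‖² f ≤ c`, then `∫ exp (-a ‖x‖²) f ≥ exp (-c)`. -/
theorem exp_neg_le_integral_mul_gaussian {d : ℕ} {f : EuclideanSpace ℝ (Fin d) → ℝ}
    (hf : IsLogConcaveBump f) (hf1 : ∫ x, f x = 1) {a c : ℝ}
    (h2 : a * ∫ x, ‖x‖ ^ 2 * f x ≤ c) :
    Real.exp (-c) ≤ ∫ x, Real.exp (-a * ‖x‖ ^ 2) * f x := by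
  have i₁ : Integrable fun x => Real.exp (-c) * ((1 + c) * f x - a * (‖x‖ ^ 2 * f x)) :=
    ((hf.integrable.const_mul _).sub
      ((hf.integrable_mul (φ := fun x => ‖x‖ ^ 2) (by fun_prop)).const_mul _)).const_mul _
  have key := integral_mono i₁ (hf.integrable_mul (φ := fun x => Real.exp (-a * ‖x‖ ^ 2))
    (by fun_prop)) fun x => by
      have h := Real.add_one_le_exp (c - a * ‖x‖ ^ 2)
      have e : Real.exp (-a * ‖x‖ ^ 2) = Real.exp (-c) * Real.exp (c - a * ‖x‖ ^ 2) := by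
        rw [← Real.exp_add]
        congr 1
        ring
      simp only [e, mul_assoc]
      refine mul_le_mul_of_nonneg_left ?_ (Real.exp_pos _).le
      nlinarith [mul_le_mul_of_nonneg_right h (hf.nonneg x)]
  refine le_trans ?_ key
  rw [integral_const_mul, integral_sub (hf.integrable.const_mul _)
    ((hf.integrable_mul (φ := fun x => ‖x‖ ^ 2) (by fun_prop)).const_mul _), integral_const_mul,
    integral_const_mul, hf1]
  nlinarith [Real.exp_pos (-c)]

/-- Let `d ≥ 1`, let `K ⊆ ℝ^d` be a convex body of volume `1` centred at the origin,
with `E[X ⊗ X] = L² I_d` for `X` uniform on `K`, and let `k ∈ ℕ` satisfy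
`2^15 L² ≤ 2^k ≤ 2^16 L²`. Then the density `f_{S_k}` of
`S_k = 2^{-k} ∑_{i=1}^{2^k} X_i` satisfies `f_{S_k}(0) ≥ e^{-d} ‖f_{S_k}‖_∞ ≥ e^d`. -/
theorem density_at_zero_lower_bound {d : ℕ} (hd : 1 ≤ d)
    (K : Set (EuclideanSpace ℝ (Fin d)))
    (hcpt : IsCompact K) (hconv : Convex ℝ K) (hint : (interior K).Nonempty)
    (hvol : volume K = 1) (L : ℝ)
    (hcentred : ∀ i : Fin d, ∫ x in K, x i = 0)
    (hcov : ∀ i j : Fin d, ∫ x in K, x i * x j = if i = j then L ^ 2 else 0)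
    (k : ℕ) (hk₁ : 2 ^ 15 * L ^ 2 ≤ (2 : ℝ) ^ k) (hk₂ : (2 : ℝ) ^ k ≤ 2 ^ 16 * L ^ 2) :
    avgDensity K (2 ^ k) 0 ≥ Real.exp (-d) * essSup (avgDensity K (2 ^ k)) volume ∧
      Real.exp (-d) * essSup (avgDensity K (2 ^ k)) volume ≥ Real.exp d := by
  set n : ℕ := 2 ^ k with hn
  have hn1 : 1 ≤ n := Nat.one_le_two_pow
  have hnpos : (0 : ℝ) < n := by exact_mod_cast hn1
  have hk : 2 ^ 15 * L ^ 2 ≤ (n : ℝ) := by rw [hn]; exact_mod_cast hk₁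
  set f := convIter (K.indicator (1 : EuclideanSpace ℝ (Fin d) → ℝ)) (n - 1) with hfdef
  have hf : IsLogConcaveBump f := isLogConcaveBump_convIter hcpt hconv hvol _
  have hf1 : ∫ x, f x = 1 := integral_convIter hcpt hconv hvol _
  have hf0 : ∀ i, ∫ x, x i * f x = 0 := fun i =>
    integral_mul_convIter hcpt hconv hvol (hcentred i) _
  have hvar : ∀ i : Fin d, ∫ x in K, x i ^ 2 = L ^ 2 := fun i => by
    simpa [pow_two] using hcov i i
  have hf2 : ∀ i, ∫ x, x i ^ 2 * f x = n * L ^ 2 := fun i => by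
    rw [integral_sq_mul_convIter hcpt hconv hvol (hcentred i) (hvar i)]
    congr 1
    rw [← Nat.cast_add_one, Nat.sub_add_cancel hn1]
  have hnorm : ∫ x, ‖x‖ ^ 2 * f x = d * (n * L ^ 2) := by
    simp only [EuclideanSpace.real_norm_sq_eq, Finset.sum_mul]
    rw [integral_finsetSum _ fun i _ => hf.integrable_mul (by fun_prop)]
    simp [hf2]
  have hle : ∀ z, avgDensity K n z ≤ Real.exp d * avgDensity K n 0 := fun z => by
    have := hf.le_exp_mul_apply_zero hf1 hf0 ((n : ℝ) • z)
    simp only [avgDensity, smul_zero, ← hfdef]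
    rw [mul_left_comm]
    gcongr
  have hnonneg : ∀ z, 0 ≤ avgDensity K n z := fun z =>
    mul_nonneg (by positivity) (hf.nonneg _)
  have hbdd : Filter.IsBoundedUnder (· ≤ ·) (ae volume) (avgDensity K n) :=
    Filter.isBoundedUnder_of ⟨_, hle⟩
  have hcobdd : Filter.IsCoboundedUnder (· ≤ ·) (ae volume) (avgDensity K n) :=
    (Filter.isBoundedUnder_of ⟨0, hnonneg⟩ :
      Filter.IsBoundedUnder (· ≥ ·) (ae volume) (avgDensity K n)).isCoboundedUnder_le
  set M := essSup (avgDensity K n) volume with hM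
  refine ⟨?_, ?_⟩
  · have : M ≤ Real.exp d * avgDensity K n 0 :=
      essSup_le_of_ae_le _ (Filter.Eventually.of_forall hle) hcobdd
    calc Real.exp (-d) * M ≤ Real.exp (-d) * (Real.exp d * avgDensity K n 0) := by gcongr
      _ = avgDensity K n 0 := by rw [← mul_assoc, ← Real.exp_add]; simp
  · have hgauss : Real.exp (-(d / 2 : ℝ)) ≤ M * (Real.pi / 2 ^ 14) ^ (d / 2 : ℝ) := by
      calc Real.exp (-(d / 2 : ℝ))
          ≤ ∫ x, Real.exp (-(2 ^ 14 / n ^ 2) * ‖x‖ ^ 2) * f x := by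
            refine exp_neg_le_integral_mul_gaussian hf hf1 ?_
            rw [hnorm, div_mul_eq_mul_div, div_le_iff₀ (by positivity)]
            have hd0 : (0 : ℝ) ≤ d := Nat.cast_nonneg d
            nlinarith [mul_le_mul_of_nonneg_left hk (mul_nonneg hd0 hnpos.le)]
        _ = ∫ z, Real.exp (-2 ^ 14 * ‖z‖ ^ 2) * avgDensity K n z := by
            have := Measure.integral_comp_smul_of_nonneg volume
              (fun x => (n : ℝ) ^ d * (Real.exp (-(2 ^ 14 / n ^ 2) * ‖x‖ ^ 2) * f x)) n
              (hR := hnpos.le)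
            rw [integral_const_mul _ (fun x => _ * f x), finrank_euclideanSpace_fin, smul_eq_mul,
              inv_mul_cancel_left₀ (by positivity)] at this
            rw [← this]
            congr 1 with z
            simp only [avgDensity, ← hfdef, norm_smul, Real.norm_natCast]
            rw [mul_left_comm]
            congr 2
            field_simp
        _ ≤ ∫ z : EuclideanSpace ℝ (Fin d), M * Real.exp (-2 ^ 14 * ‖z‖ ^ 2) := by
            have hgi : Integrable fun z : EuclideanSpace ℝ (Fin d) =>
                Real.exp (-2 ^ 14 * ‖z‖ ^ 2) := by
              refine not_imp_comm.1 integral_undef ?_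
              rw [GaussianFourier.integral_rexp_neg_mul_sq_norm (by positivity)]
              positivity
            refine integral_mono_of_nonneg (Filter.Eventually.of_forall fun z =>
              mul_nonneg (Real.exp_pos _).le (hnonneg z)) (hgi.const_mul M) ?_
            filter_upwards [ae_le_essSup hbdd] with z hz
            rw [mul_comm]
            gcongr
        _ = M * (Real.pi / 2 ^ 14) ^ (d / 2 : ℝ) := by
            rw [integral_const_mul, GaussianFourier.integral_rexp_neg_mul_sq_norm (by positivity),
              finrank_euclideanSpace_fin]
    have hsmall : Real.pi / 2 ^ 14 ≤ Real.exp (-5) := by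
      have h5 : Real.exp 5 ≤ 2 ^ 12 := by
        have e : Real.exp 5 = Real.exp 1 ^ 5 := by rw [← Real.exp_nat_mul]; norm_num
        rw [e]
        calc Real.exp 1 ^ 5 ≤ 3 ^ 5 := by
              gcongr
              exact Real.exp_one_lt_three.le
          _ ≤ 2 ^ 12 := by norm_num
      rw [Real.exp_neg, div_le_iff₀ (by positivity), ← div_eq_inv_mul,
        le_div_iff₀ (Real.exp_pos 5)]
      nlinarith [Real.pi_le_four, Real.pi_pos, Real.exp_pos 5]
    have hM0 : 0 ≤ M := by
      by_contra! h
      exact (hgauss.trans_lt (mul_neg_of_neg_of_pos h (by positivity))).not_ge (Real.exp_pos _).le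
    have hpow : (Real.pi / 2 ^ 14) ^ (d / 2 : ℝ) ≤ Real.exp (-5 * (d / 2)) := by
      rw [Real.exp_mul]
      gcongr
    have hbound := hgauss.trans (mul_le_mul_of_nonneg_left hpow hM0)
    calc Real.exp d = Real.exp (3 / 2 * d) * Real.exp (-(d / 2 : ℝ)) := by
          rw [← Real.exp_add]
          congr 1
          ring
      _ ≤ Real.exp (3 / 2 * d) * (M * Real.exp (-5 * (d / 2))) := by gcongr
      _ = Real.exp (-d) * M := by
          rw [mul_left_comm, ← Real.exp_add, mul_comm]
          congr 2
          ring
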